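/- arXiv:1805.06993 — 8 statements merged into one kernel-verified Lean document; each statement's English description precedes it below -/
import Mathlib

section
/- Let ω be a nonprincipal ultrafilter on ℕ and let (dⁱ)_{i∈ℕ} be a countable family of scaling sequences (so each dⁱ : ℕ → (0,∞) satisfies lim^ω dⁱₙ = +∞). Then the family is bounded above and below in the ω-ordering: there exist scaling sequences u and l such that for every i ∈ ℕ, one has lₙ ≤ dⁱₙ and dⁱₙ ≤ uₙ for ω-almost every n. -/
open Filter

/-- A scaling sequence for the ultrafilter `ω`: a sequence of positive reals that
tends to `+∞` along `ω` (i.e. is `ω`-divergent). -/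
def IsScalingSeq (ω : Ultrafilter ℕ) (d : ℕ → ℝ) : Prop :=
  (∀ n, 0 < d n) ∧ Tendsto d (ω : Filter ℕ) atTop

theorem Ultrafilter.eventually_ge_of_finite_notMem (ω : Ultrafilter ℕ)
    (hω : ∀ A : Set ℕ, A.Finite → A ∉ ω) (i : ℕ) : ∀ᶠ n in (ω : Filter ℕ), i ≤ n := by
  have h := Ultrafilter.compl_mem_iff_notMem.2 (hω _ (Set.finite_Iio i))
  rwa [Set.compl_Iio] at h

/-- The diagonal partial sums of a countable family of scaling sequences form an upper bound. -/
theorem exists_isScalingSeq_eventually_ge (ω : Ultrafilter ℕ)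
    (hω : ∀ A : Set ℕ, A.Finite → A ∉ ω) (d : ℕ → ℕ → ℝ) (hd : ∀ i, IsScalingSeq ω (d i)) :
    ∃ u : ℕ → ℝ, IsScalingSeq ω u ∧ ∀ i, ∀ᶠ n in (ω : Filter ℕ), d i n ≤ u n := by
  have hle : ∀ i n, i ≤ n → d i n ≤ ∑ j ∈ Finset.range (n + 1), d j n := fun i n hin =>
    Finset.single_le_sum (f := fun j => d j n) (fun j _ => ((hd j).1 n).le)
      (Finset.mem_range.2 (Nat.lt_succ_of_le hin))
  refine ⟨fun n => ∑ j ∈ Finset.range (n + 1), d j n, ⟨fun n => ?_, ?_⟩, fun i => ?_⟩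
  · exact ((hd 0).1 n).trans_le (hle 0 n n.zero_le)
  · exact tendsto_atTop_mono (fun n => hle 0 n n.zero_le) (hd 0).2
  · filter_upwards [ω.eventually_ge_of_finite_notMem hω i] with n hn using hle i n hn

/-- The diagonal minima of the truncated sequences `max (d i n) i` form a lower bound. -/
theorem exists_isScalingSeq_eventually_le (ω : Ultrafilter ℕ)
    (hω : ∀ A : Set ℕ, A.Finite → A ∉ ω) (d : ℕ → ℕ → ℝ) (hd : ∀ i, IsScalingSeq ω (d i)) :
    ∃ l : ℕ → ℝ, IsScalingSeq ω l ∧ ∀ i, ∀ᶠ n in (ω : Filter ℕ), l n ≤ d i n := by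
  refine ⟨fun n => (Finset.range (n + 1)).inf' Finset.nonempty_range_add_one
    fun i => max (d i n) i, ⟨fun n => ?_, ?_⟩, fun i => ?_⟩
  · exact (Finset.lt_inf'_iff _).2 fun i _ => lt_max_of_lt_left ((hd i).1 n)
  · refine tendsto_atTop.2 fun M => ?_
    obtain ⟨k, hk⟩ := exists_nat_ge M
    have hfin : ∀ᶠ n in (ω : Filter ℕ), ∀ i ∈ Finset.range k, M ≤ d i n :=
      (Finset.eventually_all _).2 fun i _ => (hd i).2.eventually_ge_atTop M
    filter_upwards [hfin] with n hn
    refine (Finset.le_inf'_iff _ _).2 fun i _ => ?_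
    rcases lt_or_ge i k with hik | hik
    · exact le_max_of_le_left (hn i (Finset.mem_range.2 hik))
    · exact le_max_of_le_right (hk.trans (Nat.cast_le.2 hik))
  · filter_upwards [ω.eventually_ge_of_finite_notMem hω i,
      (hd i).2.eventually_ge_atTop (i : ℝ)] with n hin hn
    exact (Finset.inf'_le _ (Finset.mem_range.2 (Nat.lt_succ_of_le hin))).trans
      (max_le le_rfl hn)

/-- Every countable family of scaling sequences is bounded above and below in the
`ω`-ordering. -/
theorem countable_family_of_scaling_sequences_bounded
    (ω : Ultrafilter ℕ) (hω : ∀ A : Set ℕ, A.Finite → A ∉ ω)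
    (d : ℕ → ℕ → ℝ) (hd : ∀ i, IsScalingSeq ω (d i)) :
    ∃ u l : ℕ → ℝ, IsScalingSeq ω u ∧ IsScalingSeq ω l ∧
      ∀ i : ℕ, ∀ᶠ n in (ω : Filter ℕ), l n ≤ d i n ∧ d i n ≤ u n := by
  obtain ⟨u, hu, hdu⟩ := exists_isScalingSeq_eventually_ge ω hω d hd
  obtain ⟨l, hl, hld⟩ := exists_isScalingSeq_eventually_le ω hω d hd
  exact ⟨u, l, hu, hl, fun i => (hld i).and (hdu i)⟩
end

section
/- Let X be a metric space, x₀ ∈ X, and let S be a convex family of geodesic rays based at x₀. Fix C > 0. Then d_C is a metric on S: for all α, β, γ ∈ S one has (i) d_C(α,β) = 0 if and only if α = β (as functions), (ii) d_C(α,β) = d_C(β,α), and (iii) d_C(α,γ) ≤ d_C(α,β) + d_C(β,γ). -/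
open Metric

/-- A geodesic ray based at `x₀`, modeled as a map `ℝ → X` whose values matter only on
`[0,∞)`. -/
def IsGeodesicRay {X : Type*} [MetricSpace X] (x₀ : X) (α : ℝ → X) : Prop :=
  α 0 = x₀ ∧ ∀ s t : ℝ, 0 ≤ s → 0 ≤ t → dist (α s) (α t) = |s - t|

/-- A family `S` of geodesic rays based at `x₀` is convex if distances between rays are
convex in the parameter (automatic in CAT(0) spaces). -/
def IsConvexRayFamily {X : Type*} [MetricSpace X] (x₀ : X) (S : Set (ℝ → X)) : Prop :=
  (∀ α ∈ S, IsGeodesicRay x₀ α) ∧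
    ∀ α ∈ S, ∀ β ∈ S, ∀ t : ℝ, 0 ≤ t → ∀ s : ℝ, 0 ≤ s → s ≤ 1 →
      dist (α (s * t)) (β (s * t)) ≤ s * dist (α t) (β t)

open scoped Classical in
/-- The metric `d_C` on geodesic rays: `d_C(α,β) = 1 / sup {t ≥ 0 : d(α(t),β(t)) ≤ C}`,
with the convention that `d_C(α,β) = 0` when the set is unbounded. -/
noncomputable def dC {X : Type*} [MetricSpace X] (C : ℝ) (α β : ℝ → X) : ℝ :=
  if BddAbove {t : ℝ | 0 ≤ t ∧ dist (α t) (β t) ≤ C} then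
    1 / sSup {t : ℝ | 0 ≤ t ∧ dist (α t) (β t) ≤ C}
  else 0

section ConvexRayFamily

variable {X : Type*} [MetricSpace X] {x₀ : X} {S : Set (ℝ → X)} {C : ℝ} {α β : ℝ → X}

theorem IsGeodesicRay.dist_le_two_mul (hα : IsGeodesicRay x₀ α) (hβ : IsGeodesicRay x₀ β)
    {t : ℝ} (ht : 0 ≤ t) : dist (α t) (β t) ≤ 2 * t := by
  have h₁ := hα.2 t 0 ht le_rfl
  have h₂ := hβ.2 0 t le_rfl ht
  rw [hα.1, sub_zero, abs_of_nonneg ht] at h₁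
  rw [hβ.1, zero_sub, abs_neg, abs_of_nonneg ht] at h₂
  linarith [dist_triangle (α t) x₀ (β t)]

theorem IsConvexRayFamily.dist_le_of_lt (hS : IsConvexRayFamily x₀ S) (hα : α ∈ S) (hβ : β ∈ S)
    {t u : ℝ} (ht : 0 ≤ t) (htu : t < u) : dist (α t) (β t) ≤ dist (α u) (β u) := by
  have hu : 0 < u := ht.trans_lt htu
  have hle : t / u ≤ 1 := (div_le_one hu).2 htu.le
  have h := hS.2 α hα β hβ u hu.le (t / u) (by positivity) hle
  rw [div_mul_cancel₀ _ hu.ne'] at h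
  exact h.trans (mul_le_of_le_one_left dist_nonneg hle)

theorem dC_nonneg : 0 ≤ dC C α β := by
  unfold dC
  split_ifs
  · exact one_div_nonneg.2 (Real.sSup_nonneg fun t ht => ht.1)
  · exact le_rfl

theorem dC_comm : dC C α β = dC C β α := by
  have h : {t : ℝ | 0 ≤ t ∧ dist (α t) (β t) ≤ C} = {t : ℝ | 0 ≤ t ∧ dist (β t) (α t) ≤ C} := by
    simp only [dist_comm]
  unfold dC
  rw [h]

theorem IsGeodesicRay.half_mem (hα : IsGeodesicRay x₀ α) (hβ : IsGeodesicRay x₀ β) (hC : 0 < C) :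
    C / 2 ∈ {t : ℝ | 0 ≤ t ∧ dist (α t) (β t) ≤ C} :=
  ⟨by positivity, (hα.dist_le_two_mul hβ (by positivity)).trans_eq (by ring)⟩

theorem IsGeodesicRay.mul_dC_le_one (hα : IsGeodesicRay x₀ α) (hβ : IsGeodesicRay x₀ β)
    (hC : 0 < C) {t : ℝ} (ht : 0 ≤ t) (h : dist (α t) (β t) ≤ C) : t * dC C α β ≤ 1 := by
  unfold dC
  split_ifs with hb
  · have hpos := (half_pos hC).trans_le (le_csSup hb (hα.half_mem hβ hC))
    rw [mul_one_div]
    exact (div_le_one hpos).2 (le_csSup hb ⟨ht, h⟩)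
  · simp

theorem IsConvexRayFamily.dist_le_of_mul_dC_lt_one (hS : IsConvexRayFamily x₀ S) (hC : 0 < C)
    (hα : α ∈ S) (hβ : β ∈ S) {t : ℝ} (ht : 0 ≤ t) (h : t * dC C α β < 1) :
    dist (α t) (β t) ≤ C := by
  have hmem := (hS.1 α hα).half_mem (hS.1 β hβ) hC
  obtain ⟨u, hu, htu⟩ : ∃ u ∈ {t : ℝ | 0 ≤ t ∧ dist (α t) (β t) ≤ C}, t < u := by
    unfold dC at h
    split_ifs at h with hb
    · have hpos := (half_pos hC).trans_le (le_csSup hb hmem)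
      rw [mul_one_div, div_lt_one hpos] at h
      exact exists_lt_of_lt_csSup ⟨_, hmem⟩ h
    · exact not_bddAbove_iff.1 hb t
  exact (hS.dist_le_of_lt hα hβ ht htu).trans hu.2

theorem IsConvexRayFamily.dist_le_mul_of_mul_dC_lt (hS : IsConvexRayFamily x₀ S) (hC : 0 < C)
    (hα : α ∈ S) (hβ : β ∈ S) {t s : ℝ} (ht : 0 ≤ t) (hs : s ≤ 1)
    (h : t * dC C α β < s) : dist (α t) (β t) ≤ s * C := by
  have hs₀ : 0 < s := (mul_nonneg ht dC_nonneg).trans_lt h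
  have hconv := hS.2 α hα β hβ (t / s) (by positivity) s hs₀.le hs
  rw [mul_div_cancel₀ _ hs₀.ne'] at hconv
  refine hconv.trans (mul_le_mul_of_nonneg_left ?_ hs₀.le)
  refine hS.dist_le_of_mul_dC_lt_one hC hα hβ (by positivity) ?_
  rwa [div_mul_eq_mul_div, div_lt_one hs₀]

theorem IsConvexRayFamily.dC_eq_zero_iff (hS : IsConvexRayFamily x₀ S) (hC : 0 < C)
    (hα : α ∈ S) (hβ : β ∈ S) : dC C α β = 0 ↔ ∀ t : ℝ, 0 ≤ t → α t = β t := by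
  constructor
  · intro h t ht
    by_contra hne
    have hd := dist_pos.2 hne
    have hC' := hS.dist_le_of_mul_dC_lt_one hC hα hβ ht (by simp [h])
    have hlt : dist (α t) (β t) / (2 * C) ≤ 1 := by
      rw [div_le_one (by positivity)]
      linarith
    have h' := hS.dist_le_mul_of_mul_dC_lt hC hα hβ ht hlt (by rw [h, mul_zero]; positivity)
    have : dist (α t) (β t) / (2 * C) * C = dist (α t) (β t) / 2 := by field_simp
    linarith
  · intro h
    by_contra hne
    have hpos : 0 < dC C α β := lt_of_le_of_ne dC_nonneg (Ne.symm hne)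
    have ht : 0 ≤ 2 / dC C α β := by positivity
    have h' := (hS.1 α hα).mul_dC_le_one (hS.1 β hβ) hC ht (by rw [h _ ht, dist_self]; exact hC.le)
    rw [div_mul_cancel₀ _ hne] at h'
    linarith

theorem IsConvexRayFamily.dC_triangle (hS : IsConvexRayFamily x₀ S) (hC : 0 < C) {γ : ℝ → X}
    (hα : α ∈ S) (hβ : β ∈ S) (hγ : γ ∈ S) : dC C α γ ≤ dC C α β + dC C β γ := by
  refine le_of_forall_pos_le_add fun ε hε => ?_
  have ha : 0 ≤ dC C α β := dC_nonneg
  have hb : 0 ≤ dC C β γ := dC_nonneg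
  set a := dC C α β
  set b := dC C β γ
  have hr : 0 < a + b + ε := by positivity
  have ht : 0 < 1 / (a + b + ε) := by positivity
  set t := 1 / (a + b + ε) with ht_def
  have hsum : t * (a + ε / 2) + t * (b + ε / 2) = 1 := by
    rw [ht_def]
    field_simp
    ring
  have hs₁ : 0 ≤ t * (a + ε / 2) := by positivity
  have hs₂ : 0 ≤ t * (b + ε / 2) := by positivity
  have h₁ : dist (α t) (β t) ≤ t * (a + ε / 2) * C :=
    hS.dist_le_mul_of_mul_dC_lt hC hα hβ ht.le (by linarith)
      (mul_lt_mul_of_pos_left (by linarith) ht)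
  have h₂ : dist (β t) (γ t) ≤ t * (b + ε / 2) * C :=
    hS.dist_le_mul_of_mul_dC_lt hC hβ hγ ht.le (by linarith)
      (mul_lt_mul_of_pos_left (by linarith) ht)
  have h₃ : dist (α t) (γ t) ≤ C := by
    calc dist (α t) (γ t) ≤ t * (a + ε / 2) * C + t * (b + ε / 2) * C :=
          (dist_triangle _ _ _).trans (add_le_add h₁ h₂)
      _ = C := by rw [← add_mul, hsum, one_mul]
  have h₄ := (hS.1 α hα).mul_dC_le_one (hS.1 γ hγ) hC ht.le h₃
  rwa [ht_def, one_div_mul_eq_div, div_le_one hr] at h₄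

end ConvexRayFamily

/-- `d_C` is a metric on any convex family of geodesic rays based at `x₀`. -/
theorem dC_is_metric {X : Type*} [MetricSpace X] (x₀ : X) (S : Set (ℝ → X))
    (hS : IsConvexRayFamily x₀ S) (C : ℝ) (hC : 0 < C)
    (α β γ : ℝ → X) (hα : α ∈ S) (hβ : β ∈ S) (hγ : γ ∈ S) :
    (dC C α β = 0 ↔ ∀ t : ℝ, 0 ≤ t → α t = β t) ∧
    dC C α β = dC C β α ∧
    dC C α γ ≤ dC C α β + dC C β γ := by
  exact ⟨hS.dC_eq_zero_iff hC hα hβ, dC_comm, hS.dC_triangle hC hα hβ hγ⟩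
end

section
/- Let X be a metric space, x₀ ∈ X, let S be a convex family of geodesic rays based at x₀, let C > 0, and let α, β ∈ S. Then: (i) for all ε and R with 0 < ε ≤ C and R > 0, if d_C(α,β) ≤ ε/(C·R) then d(α(R), β(R)) ≤ ε; (ii) for every ε > 0, if there exists s ≥ 0 with d(α(1/ε + C/2), β(s)) < C/2, then d_C(α,β) < ε. (These two inclusions show that d_C induces the visual topology on the set of based geodesic rays.) -/
open Metric

/-- Convexity turns `d(α(t),β(t)) ≤ C` at a late time `t` into a small distance at time `R`. -/
lemma IsConvexRayFamily.dist_le_of_late {X : Type*} [MetricSpace X] {x₀ : X} {S : Set (ℝ → X)}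
    (hS : IsConvexRayFamily x₀ S) {α β : ℝ → X} (hα : α ∈ S) (hβ : β ∈ S) {C ε R t : ℝ}
    (hε : 0 < ε) (hεC : ε ≤ C) (hR : 0 < R) (ht : C * R / ε ≤ t)
    (hd : dist (α t) (β t) ≤ C) : dist (α R) (β R) ≤ ε := by
  have hCR : C * R ≤ t * ε := (div_le_iff₀ hε).1 ht
  have hRt : R ≤ t := by
    have : R * ε ≤ t * ε := by nlinarith
    exact le_of_mul_le_mul_right this hε
  have ht0 : 0 < t := hR.trans_le hRt
  have h := hS.2 α hα β hβ t ht0.le (R / t) (by positivity) ((div_le_one ht0).2 hRt)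
  rw [div_mul_cancel₀ R ht0.ne'] at h
  calc dist (α R) (β R) ≤ R / t * dist (α t) (β t) := h
    _ ≤ R / t * C := by gcongr
    _ = C * R / t := by ring
    _ ≤ ε := (div_le_iff₀ ht0).2 (by linarith)

/-- The supremum of the times at which two rays are `C`-close is attained. -/
lemma IsGeodesicRay.dist_sSup_le {X : Type*} [MetricSpace X] {x₀ : X} {α β : ℝ → X}
    (hα : IsGeodesicRay x₀ α) (hβ : IsGeodesicRay x₀ β) {C : ℝ} (hC : 0 ≤ C)
    (hb : BddAbove {t : ℝ | 0 ≤ t ∧ dist (α t) (β t) ≤ C}) :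
    dist (α (sSup {t : ℝ | 0 ≤ t ∧ dist (α t) (β t) ≤ C}))
      (β (sSup {t : ℝ | 0 ≤ t ∧ dist (α t) (β t) ≤ C})) ≤ C := by
  set T := {t : ℝ | 0 ≤ t ∧ dist (α t) (β t) ≤ C}
  have hne : T.Nonempty := ⟨0, le_rfl, by rw [hα.1, hβ.1, dist_self]; exact hC⟩
  refine le_of_forall_pos_le_add fun δ hδ => ?_
  obtain ⟨t, ht, hlt⟩ := exists_lt_of_lt_csSup hne (show sSup T - δ / 2 < sSup T by linarith)
  have hle : t ≤ sSup T := le_csSup hb ht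
  have h1 := hα.2 (sSup T) t (ht.1.trans hle) ht.1
  have h2 := hβ.2 t (sSup T) ht.1 (ht.1.trans hle)
  rw [abs_of_nonneg (by linarith)] at h1
  rw [abs_of_nonpos (by linarith)] at h2
  have h3 := dist_triangle4 (α (sSup T)) (α t) (β t) (β (sSup T))
  linarith [ht.2]

/-- Reparametrizing a nearby point on another ray costs at most the distance itself. -/
lemma IsGeodesicRay.dist_same_time_le {X : Type*} [MetricSpace X] {x₀ : X} {α β : ℝ → X}
    (hα : IsGeodesicRay x₀ α) (hβ : IsGeodesicRay x₀ β) {a s : ℝ} (ha : 0 ≤ a) (hs : 0 ≤ s) :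
    dist (α a) (β a) ≤ 2 * dist (α a) (β s) := by
  have h1 := hα.2 a 0 ha le_rfl
  have h2 := hβ.2 s 0 hs le_rfl
  rw [hα.1, sub_zero, abs_of_nonneg ha] at h1
  rw [hβ.1, sub_zero, abs_of_nonneg hs] at h2
  have h3 := hβ.2 s a hs ha
  have h4 := abs_dist_sub_le (β s) (α a) x₀
  rw [h1, h2, ← h3, dist_comm (β s) (α a)] at h4
  linarith [dist_triangle (α a) (β s) (β a)]

/-- The comparison between `d_C`-balls and the visual neighborhoods `U(α,R,ε)`,
showing that `d_C` induces the visual topology on the set of based geodesic rays. -/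
theorem dC_induces_visual_topology {X : Type*} [MetricSpace X] (x₀ : X) (S : Set (ℝ → X))
    (hS : IsConvexRayFamily x₀ S) (C : ℝ) (hC : 0 < C)
    (α β : ℝ → X) (hα : α ∈ S) (hβ : β ∈ S) :
    (∀ ε R : ℝ, 0 < ε → ε ≤ C → 0 < R →
      dC C α β ≤ ε / (C * R) → dist (α R) (β R) ≤ ε) ∧
    (∀ ε : ℝ, 0 < ε →
      (∃ s : ℝ, 0 ≤ s ∧ dist (α (1 / ε + C / 2)) (β s) < C / 2) → dC C α β < ε) := by
  have hgα := hS.1 α hα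
  have hgβ := hS.1 β hβ
  constructor
  · intro ε R hε hεC hR h
    unfold dC at h
    split_ifs at h with hb
    · have hmem : C / 2 ∈ {t : ℝ | 0 ≤ t ∧ dist (α t) (β t) ≤ C} := by
        have hC2 : (0 : ℝ) ≤ C / 2 := by positivity
        have h1 := hgα.2 (C / 2) 0 hC2 le_rfl
        have h2 := hgβ.2 (C / 2) 0 hC2 le_rfl
        rw [hgα.1, sub_zero, abs_of_nonneg hC2] at h1
        rw [hgβ.1, sub_zero, abs_of_nonneg hC2] at h2
        exact ⟨hC2, by linarith [dist_triangle_right (α (C / 2)) (β (C / 2)) x₀]⟩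
      have hpos := (half_pos hC).trans_le (le_csSup hb hmem)
      refine hS.dist_le_of_late hα hβ hε hεC hR ?_ (hgα.dist_sSup_le hgβ hC.le hb)
      rw [div_le_div_iff₀ hpos (by positivity), one_mul] at h
      rw [div_le_iff₀ hε]
      linarith
    · obtain ⟨t, ht, hlt⟩ := not_bddAbove_iff.1 hb (C * R / ε)
      exact hS.dist_le_of_late hα hβ hε hεC hR hlt.le ht.2
  · rintro ε hε ⟨s, hs, hd⟩
    unfold dC
    split_ifs with hb
    · have ha : 0 < 1 / ε + C / 2 := by positivity
      have hle := le_csSup hb (show 1 / ε + C / 2 ∈ _ from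
        ⟨ha.le, by linarith [hgα.dist_same_time_le hgβ ha.le hs]⟩)
      exact (one_div_lt (ha.trans_le hle) hε).2 (by linarith)
    · exact hε
end

section
/- Let X be a metric space, x₀ ∈ X, let S be a convex family of geodesic rays based at x₀, let ω be a nonprincipal ultrafilter on ℕ, let (dₙ) be a scaling sequence, let (αₙ) be a sequence in S and α₀ ∈ S. If there exists t₀ > 0 such that lim^ω d(αₙ(t₀·dₙ), α₀(t₀·dₙ))/dₙ = 0, then for every t ≥ 0, lim^ω d(αₙ(t), α₀(t)) = 0 (i.e., the rays αₙ converge ω-almost surely to α₀ pointwise, equivalently in the visual topology). -/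
open Filter Metric

/-- If the rescaled rays `αₙ` agree with `α₀` in an asymptotic cone at some time `t₀ > 0`
(i.e. `Ψ_d^ω(t₀,(αₙ)) = Ψ_d(t₀,α₀)`), then `αₙ → α₀` in the visual topology along `ω`. -/
theorem visual_limit_of_cone_eq {X : Type*} [MetricSpace X] (x₀ : X) (S : Set (ℝ → X))
    (hS : IsConvexRayFamily x₀ S)
    (ω : Ultrafilter ℕ) (hω : ∀ A : Set ℕ, A.Finite → A ∉ ω)
    (d : ℕ → ℝ) (hd : IsScalingSeq ω d)
    (α : ℕ → ℝ → X) (hα : ∀ n, α n ∈ S) (α₀ : ℝ → X) (hα₀ : α₀ ∈ S)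
    (t₀ : ℝ) (ht₀ : 0 < t₀)
    (hlim : Tendsto (fun n => dist (α n (t₀ * d n)) (α₀ (t₀ * d n)) / d n)
      (ω : Filter ℕ) (nhds 0)) :
    ∀ t : ℝ, 0 ≤ t →
      Tendsto (fun n => dist (α n t) (α₀ t)) (ω : Filter ℕ) (nhds 0) := by
  intro t ht
  have hbound := hlim.const_mul (t / t₀)
  rw [mul_zero] at hbound
  refine squeeze_zero' (Eventually.of_forall fun _ => dist_nonneg) ?_ hbound
  filter_upwards [hd.2.eventually_ge_atTop (t / t₀)] with n hn
  have hdn : 0 < d n := hd.1 n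
  have hpos : 0 < t₀ * d n := mul_pos ht₀ hdn
  have hle : t ≤ t₀ * d n := (div_le_iff₀' ht₀).1 hn
  have hconv := hS.2 (α n) (hα n) α₀ hα₀ (t₀ * d n) hpos.le (t / (t₀ * d n))
    (by positivity) ((div_le_one hpos).2 hle)
  rw [div_mul_cancel₀ t hpos.ne'] at hconv
  rwa [div_mul_div_comm, mul_div_right_comm]
end

section
/- Let X be a metric space, x₀ ∈ X, let S be a convex family of geodesic rays based at x₀, let ω be a nonprincipal ultrafilter on ℕ, let (αₙ) be a sequence in S and α ∈ S. Assume that for every t ≥ 0, lim^ω d(αₙ(t), α(t)) = 0. Then there exists a scaling sequence d = (dₙ) such that for every scaling sequence d′ = (d′ₙ) with d′ₙ ≤ dₙ ω-almost surely, and for every t > 0, lim^ω d(αₙ(t·d′ₙ), α(t·d′ₙ))/d′ₙ = 0. -/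
open Filter Metric

/-- Along rays of a convex family, a bound on the distance at time `T` is a bound at all
earlier times. -/
theorem IsConvexRayFamily.dist_le_dist {X : Type*} [MetricSpace X] {x₀ : X} {S : Set (ℝ → X)}
    (hS : IsConvexRayFamily x₀ S) {α β : ℝ → X} (hα : α ∈ S) (hβ : β ∈ S) {u T : ℝ}
    (hu : 0 ≤ u) (hT : 0 < T) (huT : u ≤ T) :
    dist (α u) (β u) ≤ dist (α T) (β T) := by
  have hs : u / T ≤ 1 := (div_le_one hT).2 huT
  have h := hS.2 α hα β hβ T hT.le (u / T) (by positivity) hs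
  rw [div_mul_cancel₀ u hT.ne'] at h
  exact h.trans (mul_le_of_le_one_left dist_nonneg hs)

/-- If each property `P · m` holds along an ultrafilter with no finite sets, some sequence `k`
diverges along it while `P n (k n)` keeps holding. -/
theorem exists_tendsto_atTop_of_forall_eventually {ω : Ultrafilter ℕ}
    (hω : ∀ A : Set ℕ, A.Finite → A ∉ ω) {P : ℕ → ℕ → Prop} (h0 : ∀ n, P n 0)
    (hP : ∀ m, ∀ᶠ n in (ω : Filter ℕ), P n m) :
    ∃ k : ℕ → ℕ, (∀ n, P n (k n)) ∧ Tendsto k (ω : Filter ℕ) atTop := by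
  classical
  refine ⟨fun n => Nat.findGreatest (P n) n,
    fun n => Nat.findGreatest_spec (Nat.zero_le n) (h0 n), tendsto_atTop.2 fun m => ?_⟩
  have hm : ∀ᶠ n in (ω : Filter ℕ), m ≤ n := by
    have h := Ultrafilter.compl_mem_iff_notMem.2 (hω _ (Set.finite_lt_nat m))
    filter_upwards [h] with n hn
    exact not_lt.1 hn
  filter_upwards [hm, hP m] with n hn hPn
  exact Nat.le_findGreatest hn hPn

/-- If `αₙ → α` in the visual topology along `ω`, then there is a scaling sequence `d`
such that for every smaller scaling sequence `d′`, the rescaled rays `αₙ` agree with `α`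
in the asymptotic cone with scaling sequence `d′` (i.e. `Ψ_{d′}^ω(t,(αₙ)) = Ψ_{d′}(t,α)`
for all `t`). -/
theorem cone_eq_of_visual_limit {X : Type*} [MetricSpace X] (x₀ : X) (S : Set (ℝ → X))
    (hS : IsConvexRayFamily x₀ S)
    (ω : Ultrafilter ℕ) (hω : ∀ A : Set ℕ, A.Finite → A ∉ ω)
    (α : ℕ → ℝ → X) (hα : ∀ n, α n ∈ S) (α₀ : ℝ → X) (hα₀ : α₀ ∈ S)
    (hlim : ∀ t : ℝ, 0 ≤ t →
      Tendsto (fun n => dist (α n t) (α₀ t)) (ω : Filter ℕ) (nhds 0)) :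
    ∃ d : ℕ → ℝ, IsScalingSeq ω d ∧
      ∀ d' : ℕ → ℝ, IsScalingSeq ω d' → (∀ᶠ n in (ω : Filter ℕ), d' n ≤ d n) →
        ∀ t : ℝ, 0 < t →
          Tendsto (fun n => dist (α n (t * d' n)) (α₀ (t * d' n)) / d' n)
            (ω : Filter ℕ) (nhds 0) := by
  obtain ⟨k, hk, hk_top⟩ := exists_tendsto_atTop_of_forall_eventually hω
    (P := fun n m => dist (α n ((m : ℝ) ^ 2)) (α₀ ((m : ℝ) ^ 2)) ≤ 1)
    (fun n => by
      simp [(hS.1 _ (hα n)).1, (hS.1 _ hα₀).1])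
    (fun m => (hlim ((m : ℝ) ^ 2) (by positivity)).eventually_le_const one_pos)
  have hk_real : Tendsto (fun n => (k n : ℝ)) (ω : Filter ℕ) atTop :=
    tendsto_natCast_atTop_atTop.comp hk_top
  refine ⟨fun n => k n + 1, ⟨fun n => by positivity, tendsto_atTop_add_const_right _ _ hk_real⟩,
    fun d' hd' hle t ht => ?_⟩
  refine tendsto_of_tendsto_of_tendsto_of_le_of_le' tendsto_const_nhds
    (tendsto_inv_atTop_zero.comp hd'.2)
    (Eventually.of_forall fun n => div_nonneg dist_nonneg (hd'.1 n).le) ?_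
  filter_upwards [hle, hk_real.eventually_ge_atTop (2 * t), hk_real.eventually_ge_atTop 1]
    with n hn hkt hk1
  have hd'_pos := hd'.1 n
  have hbound : t * d' n ≤ (k n : ℝ) ^ 2 := by
    calc t * d' n ≤ t * (k n + 1) := by gcongr
      _ ≤ t * (2 * k n) := by gcongr; linarith
      _ = 2 * t * k n := by ring
      _ ≤ k n * k n := by gcongr
      _ = (k n : ℝ) ^ 2 := by ring
  have hdist := (hS.dist_le_dist (hα n) hα₀ (by positivity) (by positivity) hbound).trans (hk n)
  simpa only [Function.comp_apply, one_div] using div_le_div_of_nonneg_right hdist hd'_pos.le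
end

section
/- Let X be a proper metric space (closed balls are compact), x₀ ∈ X, and assume the family S of all geodesic rays based at x₀ is convex. Let ω be a nonprincipal ultrafilter on ℕ, let (αₙ) be a sequence in S and α₀ ∈ S. Then the following are equivalent: (a) for every t ≥ 0, d(αₙ(t), α₀(t)) → 0 as n → ∞ (i.e., αₙ converges to α₀ in the visual topology); (b) for every bijection σ : ℕ → ℕ there exists a scaling sequence d = (dₙ) such that for every t > 0, lim^ω d(α_{σ(n)}(t·dₙ), α₀(t·dₙ))/dₙ = 0. -/
open Filter Metric

theorem Filter.exists_equiv_preimage_mem_ultrafilter (ω : Ultrafilter ℕ)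
    (hω : ∀ A : Set ℕ, A.Finite → A ∉ ω) {B : Set ℕ} (hB : B.Infinite) :
    ∃ σ : ℕ ≃ ℕ, σ ⁻¹' B ∈ ω := by
  classical
  have split : ∀ s : Set ℕ, s.Infinite → ∃ t ⊆ s, t.Infinite ∧ (s \ t).Infinite := by
    intro s hs
    obtain ⟨t, u, htu, hd, hc⟩ := hs.exists_union_disjoint_cardinal_eq_of_infinite
    have hiff : t.Finite ↔ u.Finite := by
      rw [← Cardinal.lt_aleph0_iff_set_finite, ← Cardinal.lt_aleph0_iff_set_finite, hc]
    have hu : s \ t = u := by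
      rw [← htu, Set.union_sdiff_left, hd.sdiff_eq_right]
    refine ⟨t, htu ▸ Set.subset_union_left, ?_, ?_⟩
    · intro ht
      exact hs (htu ▸ ht.union (hiff.1 ht))
    · rw [hu]
      intro hu
      exact hs (htu ▸ (hiff.2 hu).union hu)
  obtain ⟨A, hAω, hAc⟩ : ∃ A ∈ ω, Aᶜ.Infinite := by
    obtain ⟨t, -, ht, htc⟩ := split Set.univ Set.infinite_univ
    rw [← Set.compl_eq_univ_sdiff] at htc
    rcases ω.mem_or_compl_mem t with h | h
    · exact ⟨t, h, htc⟩
    · exact ⟨tᶜ, h, by rwa [compl_compl]⟩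
  have hA : A.Infinite := fun h => hω A h hAω
  obtain ⟨B', hB'B, hB', hB'c⟩ := split B hB
  have hB'c : B'ᶜ.Infinite := hB'c.mono fun x hx => hx.2
  have := hA.to_subtype
  have := hAc.to_subtype
  have := hB'.to_subtype
  have := hB'c.to_subtype
  obtain ⟨e⟩ : Nonempty (A ≃ B') := nonempty_equiv_of_countable
  obtain ⟨f⟩ : Nonempty (↥Aᶜ ≃ ↥B'ᶜ) := nonempty_equiv_of_countable
  refine ⟨(Equiv.Set.sumCompl A).symm.trans ((e.sumCongr f).trans (Equiv.Set.sumCompl B')),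
    mem_of_superset hAω fun x hx => hB'B ?_⟩
  simp [Equiv.Set.sumCompl_symm_apply_of_mem hx]

theorem IsConvexRayFamily.dist_div_le {X : Type*} [MetricSpace X] {x₀ : X} {S : Set (ℝ → X)}
    (hS : IsConvexRayFamily x₀ S) {α β : ℝ → X} (hα : α ∈ S) (hβ : β ∈ S) {s t : ℝ}
    (hs : 0 < s) (hst : s ≤ t) :
    dist (α s) (β s) / s ≤ dist (α t) (β t) / t := by
  have ht : 0 < t := hs.trans_le hst
  have h := hS.2 α hα β hβ t ht.le (s / t) (by positivity) ((div_le_one ht).2 hst)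
  rw [div_mul_cancel₀ s ht.ne'] at h
  rw [div_le_iff₀ hs]
  exact h.trans_eq (by ring)

theorem IsConvexRayFamily.dist_le {X : Type*} [MetricSpace X] {x₀ : X} {S : Set (ℝ → X)}
    (hS : IsConvexRayFamily x₀ S) {α β : ℝ → X} (hα : α ∈ S) (hβ : β ∈ S) {s t : ℝ}
    (hs : 0 < s) (hst : s ≤ t) :
    dist (α s) (β s) ≤ dist (α t) (β t) := by
  have ht : 0 < t := hs.trans_le hst
  have h := hS.2 α hα β hβ t ht.le (s / t) (by positivity) ((div_le_one ht).2 hst)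
  rw [div_mul_cancel₀ s ht.ne'] at h
  exact h.trans (mul_le_of_le_one_left dist_nonneg ((div_le_one ht).2 hst))

/-- If `βₙ` converges to `β` pointwise, it does so in the asymptotic cone for all sufficiently
slowly growing scaling sequences; the sequence built here diverges along `atTop`. -/
theorem IsConvexRayFamily.exists_scaling {X : Type*} [MetricSpace X] {x₀ : X} {S : Set (ℝ → X)}
    (hS : IsConvexRayFamily x₀ S) {α : ℕ → ℝ → X} {β : ℝ → X} (hα : ∀ n, α n ∈ S) (hβ : β ∈ S)
    (h : ∀ t : ℝ, 0 ≤ t → Tendsto (fun n => dist (α n t) (β t)) atTop (nhds 0)) :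
    ∃ d : ℕ → ℝ, (∀ n, 0 < d n) ∧ Tendsto d atTop atTop ∧
      ∀ t : ℝ, 0 < t →
        Tendsto (fun n => dist (α n (t * d n)) (β (t * d n)) / d n) atTop (nhds 0) := by
  classical
  let P : ℕ → ℕ → Prop := fun n k => dist (α n (k * (k + 1))) (β (k * (k + 1))) ≤ 1
  let k : ℕ → ℕ := fun n => Nat.findGreatest (P n) n
  have hP : ∀ n, P n (k n) := fun n => by
    refine Nat.findGreatest_spec (P := P n) (Nat.zero_le n) ?_
    simp [P, (hS.1 _ (hα n)).1, (hS.1 _ hβ).1]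
  have hk : Tendsto k atTop atTop := by
    refine tendsto_atTop.2 fun m => ?_
    filter_upwards [(h (m * (m + 1)) (by positivity)).eventually_le_const zero_lt_one,
      eventually_ge_atTop m] with n hn hmn
    exact Nat.le_findGreatest hmn hn
  have hd : Tendsto (fun n => (k n : ℝ) + 1) atTop atTop :=
    tendsto_atTop_add_const_right _ _ (tendsto_natCast_atTop_atTop.comp hk)
  refine ⟨fun n => k n + 1, fun n => by positivity, hd, fun t ht => ?_⟩
  refine squeeze_zero' (Eventually.of_forall fun n => by positivity) ?_ hd.inv_tendsto_atTop
  filter_upwards [(tendsto_natCast_atTop_atTop.comp hk).eventually_ge_atTop t] with n hn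
  have hle : t * ((k n : ℝ) + 1) ≤ k n * (k n + 1) :=
    mul_le_mul_of_nonneg_right hn (by positivity)
  rw [Pi.inv_apply, ← one_div]
  gcongr
  exact (hS.dist_le (hα n) hβ (by positivity) hle).trans (hP n)

/-- Recovering the visual topology from asymptotic cones: for a proper metric space whose
geodesic rays from `x₀` form a convex family, a sequence of rays `αₙ` converges to `α₀`
in the visual boundary if and only if for every bijection `σ : ℕ → ℕ` there is a scaling
sequence `d` with `Ψ_d^ω(t,(α_{σ(n)})) = Ψ_d(t,α₀)` for all `t`. -/
theorem visual_recovery {X : Type*} [MetricSpace X] [ProperSpace X] (x₀ : X)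
    (hconv : IsConvexRayFamily x₀ {α : ℝ → X | IsGeodesicRay x₀ α})
    (ω : Ultrafilter ℕ) (hω : ∀ A : Set ℕ, A.Finite → A ∉ ω)
    (α : ℕ → ℝ → X) (hα : ∀ n, IsGeodesicRay x₀ (α n))
    (α₀ : ℝ → X) (hα₀ : IsGeodesicRay x₀ α₀) :
    (∀ t : ℝ, 0 ≤ t → Tendsto (fun n => dist (α n t) (α₀ t)) atTop (nhds 0)) ↔
      (∀ σ : ℕ → ℕ, Function.Bijective σ →
        ∃ d : ℕ → ℝ, IsScalingSeq ω d ∧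
          ∀ t : ℝ, 0 < t →
            Tendsto (fun n => dist (α (σ n) (t * d n)) (α₀ (t * d n)) / d n)
              (ω : Filter ℕ) (nhds 0)) := by
  have hωcof : (ω : Filter ℕ) ≤ atTop := by
    rw [← Nat.cofinite_eq_atTop]
    intro A hA
    by_contra hAω
    exact hω Aᶜ (mem_cofinite.1 hA) (Ultrafilter.compl_mem_iff_notMem.2 hAω)
  constructor
  · intro h σ hσ
    obtain ⟨d, hd, hdtop, hlim⟩ := hconv.exists_scaling (fun n => hα (σ n)) hα₀
      fun t ht => (h t ht).comp hσ.injective.nat_tendsto_atTop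
    exact ⟨d, ⟨hd, hdtop.mono_left hωcof⟩, fun t ht => (hlim t ht).mono_left hωcof⟩
  · intro h t ht
    rcases ht.eq_or_lt with rfl | ht
    · simp [(hα _).1, hα₀.1]
    by_contra hnot
    obtain ⟨ε, hε, hfreq⟩ : ∃ ε > 0, ∃ᶠ n in atTop, ε ≤ dist (α n t) (α₀ t) := by
      contrapose! hnot
      refine tendsto_order.2 ⟨fun a ha => Eventually.of_forall fun n => ha.trans_le dist_nonneg,
        fun ε hε => ?_⟩
      simpa using hnot ε hε
    obtain ⟨σ, hσ⟩ := Filter.exists_equiv_preimage_mem_ultrafilter ω hω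
      (Nat.frequently_atTop_iff_infinite.1 hfreq)
    obtain ⟨d, ⟨hd, hdtop⟩, hlim⟩ := h σ σ.bijective
    have hbad : ∀ᶠ n in (ω : Filter ℕ), ε ≤ dist (α (σ n) t) (α₀ t) := hσ
    obtain ⟨n, hn, hsmall, hdn⟩ := (hbad.and
      (((hlim 1 one_pos).eventually_lt_const (div_pos hε ht)).and
        (hdtop.eventually_ge_atTop t))).exists
    rw [one_mul] at hsmall
    have hle := hconv.dist_div_le (hα (σ n)) hα₀ ht hdn
    have : ε / t ≤ dist (α (σ n) t) (α₀ t) / t := by gcongr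
    linarith
end

section
/- Let X and Y be metric spaces. Assume Y is geodesic: for all y₁, y₂ ∈ Y there is a map γ : [0, d(y₁,y₂)] → Y with γ(0) = y₁, γ(d(y₁,y₂)) = y₂, and d(γ(s),γ(t)) = |s − t| for all s,t in the domain. Let π : Y → X be a locally isometric covering map in the sense that for every y ∈ Y there exists ε > 0 such that π maps the open ball B_ε(y) bijectively onto the open ball B_ε(π(y)) and d(π(p),π(q)) = d(p,q) for all p,q ∈ B_ε(y). Let L ≥ 0, let f : X → X be L-Lipschitz, and let f̃ : Y → Y be continuous with π ∘ f̃ = f ∘ π. Then f̃ is L-Lipschitz. -/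
open Metric

/-- A continuous lift of an `L`-Lipschitz map through a locally isometric covering map of a
geodesic space is itself `L`-Lipschitz. -/
theorem lift_lipschitz {X Y : Type*} [MetricSpace X] [MetricSpace Y]
    (hgeo : ∀ y₁ y₂ : Y, ∃ γ : ℝ → Y, γ 0 = y₁ ∧ γ (dist y₁ y₂) = y₂ ∧
      ∀ s t : ℝ, 0 ≤ s → s ≤ dist y₁ y₂ → 0 ≤ t → t ≤ dist y₁ y₂ →
        dist (γ s) (γ t) = |s - t|)
    (π : Y → X)
    (hcov : ∀ y : Y, ∃ ε : ℝ, 0 < ε ∧ Set.BijOn π (ball y ε) (ball (π y) ε) ∧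
      ∀ p ∈ ball y ε, ∀ q ∈ ball y ε, dist (π p) (π q) = dist p q)
    (L : ℝ) (hL : 0 ≤ L)
    (f : X → X) (hf : ∀ x₁ x₂ : X, dist (f x₁) (f x₂) ≤ L * dist x₁ x₂)
    (ftil : Y → Y) (hcont : Continuous ftil) (hlift : π ∘ ftil = f ∘ π) :
    ∀ p q : Y, dist (ftil p) (ftil q) ≤ L * dist p q := by
  have hloc : ∀ u : Y, ∃ δ : ℝ, 0 < δ ∧ ∀ v : Y, dist v u < δ →
      dist (ftil u) (ftil v) ≤ L * dist u v := by
    intro u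
    obtain ⟨ε, hε, -, hiso⟩ := hcov u
    obtain ⟨η, hη, -, hiso'⟩ := hcov (ftil u)
    obtain ⟨δ, hδ, hball⟩ := Metric.continuous_iff.1 hcont u η hη
    refine ⟨min δ ε, lt_min hδ hε, fun v hv => ?_⟩
    have hfu : π (ftil u) = f (π u) := congrFun hlift u
    have hfv : π (ftil v) = f (π v) := congrFun hlift v
    rw [← hiso' _ (mem_ball_self hη) _ (hball v (hv.trans_le (min_le_left _ _))), hfu, hfv,
      ← hiso _ (mem_ball_self hε) _ (hv.trans_le (min_le_right _ _))]
    exact hf _ _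
  intro p q
  obtain ⟨γ, hγ0, hγ1, hγ⟩ := hgeo p q
  have hγcont : ContinuousOn γ (Set.Icc 0 (dist p q)) :=
    (LipschitzOnWith.of_dist_le_mul (K := 1) fun s hs t ht => by
      rw [hγ s t hs.1 hs.2 ht.1 ht.2, Real.dist_eq, NNReal.coe_one, one_mul]).continuousOn
  have hclosed : IsClosed ({t | dist (ftil p) (ftil (γ t)) ≤ L * t} ∩
      Set.Icc 0 (dist p q)) := by
    rw [Set.inter_comm]
    exact isClosed_Icc.isClosed_le (continuous_dist.comp_continuousOn
      (continuousOn_const.prodMk (hcont.comp_continuousOn hγcont)))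
      (continuousOn_const.mul continuousOn_id)
  have hmem : dist p q ∈ {t | dist (ftil p) (ftil (γ t)) ≤ L * t} := by
    refine hclosed.mem_of_ge_of_forall_exists_gt (by simp [hγ0]) dist_nonneg ?_
    rintro x ⟨hxS, hx0, hx1⟩
    obtain ⟨δ, hδ, hδL⟩ := hloc (γ x)
    obtain ⟨y, hxy, hy⟩ := exists_between (lt_min hx1 (lt_add_of_pos_right x hδ))
    have hy1 : y ≤ dist p q := (hy.trans_le (min_le_left _ _)).le
    have hyδ : y < x + δ := hy.trans_le (min_le_right _ _)
    have hdist : dist (γ x) (γ y) = y - x := by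
      rw [hγ x y hx0 hx1.le (hx0.trans hxy.le) hy1, abs_sub_comm, abs_of_pos (sub_pos.2 hxy)]
    have hstep := hδL (γ y) (by rw [dist_comm, hdist]; linarith)
    rw [hdist] at hstep
    refine ⟨y, ?_, hxy, hy1⟩
    simp only [Set.mem_ofPred_eq] at hxS ⊢
    linarith [dist_triangle (ftil p) (ftil (γ x)) (ftil (γ y))]
  simpa [hγ1] using hmem
end

section
/- Let X be a metric space, let γ be a Morse (L₁,C₁)-quasi-geodesic ray in X, and let γ′ be an (L₂,C₂)-quasi-geodesic ray in X whose image is at finite Hausdorff distance from the image of γ (there exists M such that each of the two images is contained in the closed M-neighborhood of the other). Then γ′ is also Morse. -/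
/-- An `(L,C)`-quasi-geodesic ray in a metric space, modeled as a map `ℝ → X` whose
values matter only on `[0,∞)`. -/
def IsQuasiGeodesicRay {X : Type*} [MetricSpace X] (L C : ℝ) (γ : ℝ → X) : Prop :=
  1 ≤ L ∧ 0 ≤ C ∧ ∀ s t : ℝ, 0 ≤ s → 0 ≤ t →
    (1 / L) * |s - t| - C ≤ dist (γ s) (γ t) ∧ dist (γ s) (γ t) ≤ L * |s - t| + C

/-- An `(L,C)`-quasi-geodesic segment defined on `[a,b]`, modeled as a map `ℝ → X`. -/
def IsQuasiGeodesicSegment {X : Type*} [MetricSpace X] (L C a b : ℝ) (q : ℝ → X) : Prop :=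
  ∀ s t : ℝ, a ≤ s → s ≤ b → a ≤ t → t ≤ b →
    (1 / L) * |s - t| - C ≤ dist (q s) (q t) ∧ dist (q s) (q t) ≤ L * |s - t| + C

/-- A quasi-geodesic ray `γ` is Morse if for all `L ≥ 1`, `C ≥ 0` there is `M` such that
every `(L,C)`-quasi-geodesic segment with endpoints on the image of `γ` stays within the
closed `M`-neighborhood of the image of `γ`. -/
def IsMorse {X : Type*} [MetricSpace X] (γ : ℝ → X) : Prop :=
  ∀ L C : ℝ, 1 ≤ L → 0 ≤ C → ∃ M : ℝ,
    ∀ a b : ℝ, a ≤ b → ∀ q : ℝ → X, IsQuasiGeodesicSegment L C a b q →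
      (∃ s : ℝ, 0 ≤ s ∧ q a = γ s) → (∃ s : ℝ, 0 ≤ s ∧ q b = γ s) →
      ∀ t : ℝ, a ≤ t → t ≤ b → ∃ s : ℝ, 0 ≤ s ∧ dist (q t) (γ s) ≤ M

theorem IsQuasiGeodesicSegment.of_dist_le {X : Type*} [MetricSpace X] {L C M a b : ℝ}
    {q q' : ℝ → X} (hq : IsQuasiGeodesicSegment L C a b q)
    (hM : ∀ t, a ≤ t → t ≤ b → dist (q t) (q' t) ≤ M) :
    IsQuasiGeodesicSegment L (C + 2 * M) a b q' := by
  intro s t hs hs' ht ht'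
  obtain ⟨hlower, hupper⟩ := hq s t hs hs' ht ht'
  have hqs := hM s hs hs'
  have hqt := hM t ht ht'
  have htri := dist_triangle4 (q s) (q' s) (q' t) (q t)
  have htri' := dist_triangle4 (q' s) (q s) (q t) (q' t)
  rw [dist_comm (q' t) (q t)] at htri
  rw [dist_comm (q' s) (q s)] at htri'
  constructor <;> linarith

/-- A quasi-geodesic ray at finite Hausdorff distance from a Morse quasi-geodesic ray is
itself Morse. -/
theorem morse_of_finite_hausdorff_distance {X : Type*} [MetricSpace X]
    (L₁ C₁ L₂ C₂ : ℝ) (γ γ' : ℝ → X)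
    (hγ : IsQuasiGeodesicRay L₁ C₁ γ) (hγ' : IsQuasiGeodesicRay L₂ C₂ γ')
    (hmorse : IsMorse γ)
    (hclose : ∃ M : ℝ, (∀ s : ℝ, 0 ≤ s → ∃ t : ℝ, 0 ≤ t ∧ dist (γ s) (γ' t) ≤ M) ∧
      (∀ t : ℝ, 0 ≤ t → ∃ s : ℝ, 0 ≤ s ∧ dist (γ' t) (γ s) ≤ M)) :
    IsMorse γ' := by
  obtain ⟨M, hM, hM'⟩ := hclose
  have hM_nonneg : 0 ≤ M := by
    obtain ⟨t, -, ht⟩ := hM 0 le_rfl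
    exact dist_nonneg.trans ht
  intro L C hL hC
  obtain ⟨N, hN⟩ := hmorse L (C + 2 * M) hL (by positivity)
  refine ⟨M + N + M, ?_⟩
  rintro a b hab q hq ⟨u, hu, hqa⟩ ⟨v, hv, hqb⟩ t hat htb
  obtain ⟨u', hu', hdu⟩ := hM' u hu
  obtain ⟨v', hv', hdv⟩ := hM' v hv
  rw [← hqa] at hdu
  rw [← hqb] at hdv
  -- Move the endpoints of `q` onto `γ`.
  let q' : ℝ → X := Function.update (Function.update q a (γ u')) b (γ v')
  have hqq' : ∀ r, dist (q r) (q' r) ≤ M := by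
    intro r
    by_cases hrb : r = b
    · subst hrb
      simpa [q'] using hdv
    · by_cases hra : r = a
      · subst hra
        simpa [q', hrb] using hdu
      · simpa [q', hra, hrb] using hM_nonneg
  have hq'a : ∃ s : ℝ, 0 ≤ s ∧ q' a = γ s := by
    by_cases h : a = b
    · exact ⟨v', hv', by simp [q', h]⟩
    · exact ⟨u', hu', by simp [q', h]⟩
  obtain ⟨s, hs, hds⟩ := hN a b hab q' (hq.of_dist_le fun r _ _ ↦ hqq' r) hq'a
    ⟨v', hv', by simp [q']⟩ t hat htb
  obtain ⟨w, hw, hdw⟩ := hM s hs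
  refine ⟨w, hw, (dist_triangle4 (q t) (q' t) (γ s) (γ' w)).trans ?_⟩
  linarith [hqq' t]
end
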